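/- Let d ≥ 1 and ρ > 0. Then lim_{γ→1, γ≠1} χ^{DB}_γ(ρ) = χ^{DE}(ρ), where the limit is taken through values γ ∈ [0, 1+2/d) with γ ≠ 1. -/

import Mathlib

open MeasureTheory Filter
open scoped ENNReal NNReal Topology

/-- The lattice `ℤ^d`. -/
abbrev Zd (d : ℕ) := Fin d → ℤ

/-- Real power with the convention `0 ^ 0 = 0`. -/
noncomputable def mpow (x γ : ℝ) : ℝ := if x = 0 then 0 else x ^ γ

/-- `p` is a probability measure on `ℤ^d`, identified with its mass function. -/
def IsProb {d : ℕ} (p : Zd d → ℝ) : Prop := (∀ z, 0 ≤ p z) ∧ HasSum p 1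

/-- The discrete Dirichlet form `S(p) = -(Δ√p, √p)`, with values in `[0,∞]`. -/
noncomputable def dirS {d : ℕ} (p : Zd d → ℝ) : ℝ≥0∞ :=
  2⁻¹ * ∑' z : Zd d, ∑' x : Zd d,
    if (∑ i, |x i - z i|) = 1 then
      ENNReal.ofReal ((Real.sqrt (p x) - Real.sqrt (p z)) ^ 2) else 0

/-- The functional whose infimum is `χ^{DB}_γ(ρ)`. -/
noncomputable def FDB {d : ℕ} (γ ρ : ℝ) (p : Zd d → ℝ) : ℝ≥0∞ :=
  dirS p + ∑' z : Zd d, ENNReal.ofReal (ρ / (1 - γ) * (mpow (p z) γ - p z))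

noncomputable def chiDB (d : ℕ) (γ ρ : ℝ) : ℝ≥0∞ :=
  ⨅ p : {p : Zd d → ℝ // IsProb p}, FDB γ ρ p.1

/-- The functional whose infimum is `χ^{DE}(ρ)`. -/
noncomputable def FDE {d : ℕ} (ρ : ℝ) (p : Zd d → ℝ) : ℝ≥0∞ :=
  dirS p + ∑' z : Zd d, ENNReal.ofReal (-(ρ * (p z * Real.log (p z))))

noncomputable def chiDE (d : ℕ) (ρ : ℝ) : ℝ≥0∞ :=
  ⨅ p : {p : Zd d → ℝ // IsProb p}, FDE ρ p.1

/-- Admissible test functions: smooth, compactly supported, `L²`-normalised. -/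
def TestFun (d : ℕ) (g : EuclideanSpace ℝ (Fin d) → ℝ) : Prop :=
  ContDiff ℝ (⊤ : ℕ∞) g ∧ HasCompactSupport g ∧ ∫ x, (g x) ^ 2 = 1

noncomputable def chiAB (d : ℕ) (ρ : ℝ) : ℝ :=
  sInf {v : ℝ | ∃ g : EuclideanSpace ℝ (Fin d) → ℝ, TestFun d g ∧
    v = ∫ x, ‖fderiv ℝ g x‖ ^ 2 - ρ * ∫ x, (g x) ^ 2 * Real.log ((g x) ^ 2)}

noncomputable def chiB (d : ℕ) (γ ρ : ℝ) : ℝ :=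
  sInf {v : ℝ | ∃ g : EuclideanSpace ℝ (Fin d) → ℝ, TestFun d g ∧
    v = ∫ x, ‖fderiv ℝ g x‖ ^ 2 + ρ / (1 - γ) * ∫ x, (mpow ((g x) ^ 2) γ - (g x) ^ 2)}

noncomputable def chiRWRS (d : ℕ) (H : ℝ → ℝ) (θ : ℝ) : ℝ :=
  sInf {v : ℝ | ∃ g : EuclideanSpace ℝ (Fin d) → ℝ, TestFun d g ∧
    v = ∫ x, ‖fderiv ℝ g x‖ ^ 2 - θ * ∫ x, H ((g x) ^ 2)}

/-- `f` is regularly varying (at infinity) with index `idx`. -/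
def RegVary (f : ℝ → ℝ) (idx : ℝ) : Prop :=
  ∀ y : ℝ, 0 < y → Tendsto (fun t => f (t * y) / f t) atTop (𝓝 (y ^ idx))

noncomputable def hatH (γ y : ℝ) : ℝ :=
  if γ = 1 then y * Real.log y else (y - mpow y γ) / (1 - γ)

/-- Assumption (H) of the paper. -/
structure AssumptionH (H : ℝ → ℝ) (γ ρ : ℝ) (khat : ℝ → ℝ) : Prop where
  hγ : 0 ≤ γ
  hρ : 0 < ρ
  khat_pos : ∀ t, 0 < t → 0 < khat t
  khat_cont : ContinuousOn khat (Set.Ioi 0)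
  khat_rv : RegVary khat γ
  conv : ∀ K : Set ℝ, IsCompact K → K ⊆ Set.Ici 0 →
    TendstoUniformlyOn (fun t y => (H (t * y) - y * H t) / khat t)
      (fun y => ρ * hatH γ y) atTop K

/-- The discrete Laplacian on `ℤ^d`. -/
noncomputable def discLap {d : ℕ} (f : Zd d → ℝ) (z : Zd d) : ℝ :=
  ∑ i : Fin d,
    ((f (fun j => z j + if j = i then 1 else 0) - f z) +
     (f (fun j => z j - if j = i then 1 else 0) - f z))

/-- `u` is a nonnegative solution of the PAM equation with diffusion constant `κt`,
potential `ξ` and localised initial condition. -/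
def IsSolPAM {d : ℕ} (κt : ℝ) (ξ : Zd d → ℝ) (u : ℝ → Zd d → ℝ) : Prop :=
  (∀ s z, 0 ≤ u s z) ∧
  (∀ z, u 0 z = if z = 0 then 1 else 0) ∧
  (∀ s, 0 < s → ∀ z,
    HasDerivAt (fun s' => u s' z) (κt * discLap (fun x => u s x) z + ξ z * u s z) s)

/-- `u` is the minimal nonnegative solution. -/
def MinimalSol {d : ℕ} (κt : ℝ) (ξ : Zd d → ℝ) (u : ℝ → Zd d → ℝ) : Prop :=
  IsSolPAM κt ξ u ∧ ∀ v, IsSolPAM κt ξ v → ∀ s z, u s z ≤ v s z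

theorem IsProb.le_one {d : ℕ} {p : Zd d → ℝ} (hp : IsProb p) (z : Zd d) : p z ≤ 1 :=
  le_hasSum hp.2 z fun j _ => hp.1 j

theorem IsProb.tsum_ofReal_mul {d : ℕ} {p : Zd d → ℝ} (hp : IsProb p) {c : ℝ} (hc : 0 ≤ c) :
    ∑' z, ENNReal.ofReal (c * p z) = ENNReal.ofReal c := by
  rw [← ENNReal.ofReal_tsum_of_nonneg (fun z => mul_nonneg hc (hp.1 z)) (hp.2.summable.mul_left c),
    tsum_mul_left, hp.2.tsum_eq, mul_one]

/-- Soft thresholding of the square root of `x` at level `ε`, squared. -/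
noncomputable def softThreshold (ε x : ℝ) : ℝ := (max (√x - ε) 0) ^ 2

theorem softThreshold_nonneg (ε x : ℝ) : 0 ≤ softThreshold ε x := sq_nonneg _

theorem softThreshold_le {ε x : ℝ} (hε : 0 ≤ ε) (hx : 0 ≤ x) : softThreshold ε x ≤ x := by
  have h : max (√x - ε) 0 ≤ √x := max_le (by linarith) (Real.sqrt_nonneg x)
  calc softThreshold ε x ≤ √x ^ 2 := pow_le_pow_left₀ (le_max_right _ _) h 2
    _ = x := Real.sq_sqrt hx

theorem softThreshold_eq_zero {ε x : ℝ} (hε : 0 ≤ ε) (h : x ≤ ε ^ 2) : softThreshold ε x = 0 := by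
  have : √x ≤ ε := Real.sqrt_le_iff.2 ⟨hε, h⟩
  simp [softThreshold, max_eq_right (sub_nonpos.2 this)]

theorem sub_softThreshold_le {ε x : ℝ} (hε : 0 ≤ ε) (hx : ε < x) (hx1 : x ≤ 1) :
    x - softThreshold ε x ≤ 2 * √ε * x := by
  have hs : √ε ≤ √x := Real.sqrt_le_sqrt hx.le
  have hsε := Real.sq_sqrt hε
  have hsx := Real.sq_sqrt (hε.trans hx.le)
  have h0 := Real.sqrt_nonneg ε
  have h1 := Real.sqrt_nonneg x
  have hxx : x ≤ √x := Real.le_sqrt_of_sq_le (by nlinarith)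
  rw [softThreshold, max_eq_left (by linarith)]
  have : √x * ε ≤ √ε * x := by
    nlinarith [mul_nonneg (mul_nonneg h0 h1) (sub_nonneg.2 hs)]
  nlinarith [sq_nonneg ε]

theorem neg_mul_log_le_add_sub {x y : ℝ} (hy : 0 ≤ y) (hyx : y ≤ x) (hx : x ≤ 1) :
    -(y * Real.log y) ≤ -(x * Real.log x) + (x - y) := by
  rcases hy.eq_or_lt with rfl | hy
  · have := Real.mul_log_nonpos hyx hx
    simp only [zero_mul, neg_zero]; linarith
  have hx0 := hy.trans_le hyx
  have h1 := Real.log_le_sub_one_of_pos (div_pos hx0 hy)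
  rw [Real.log_div hx0.ne' hy.ne'] at h1
  have h2 : y * (Real.log x - Real.log y) ≤ x - y := by
    calc _ ≤ y * (x / y - 1) := mul_le_mul_of_nonneg_left h1 hy.le
      _ = x - y := by field_simp
  nlinarith [mul_nonneg (sub_nonneg.2 hyx) (neg_nonneg.2 (Real.log_nonpos hx0.le hx))]

/-- The normalised soft thresholding of a probability measure. -/
noncomputable def truncation {d : ℕ} (ε : ℝ) (p : Zd d → ℝ) (z : Zd d) : ℝ :=
  softThreshold ε (p z) / ∑' x, softThreshold ε (p x)

section Truncation

variable {d : ℕ} {p : Zd d → ℝ} {ε : ℝ}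

theorem IsProb.summable_softThreshold (hp : IsProb p) (hε : 0 ≤ ε) :
    Summable fun z => softThreshold ε (p z) :=
  hp.2.summable.of_nonneg_of_le (fun _ => softThreshold_nonneg _ _)
    fun z => softThreshold_le hε (hp.1 z)

theorem IsProb.tsum_softThreshold_le_one (hp : IsProb p) (hε : 0 ≤ ε) :
    ∑' z, softThreshold ε (p z) ≤ 1 := by
  rw [← hp.2.tsum_eq]
  exact (hp.summable_softThreshold hε).tsum_le_tsum (fun z => softThreshold_le hε (hp.1 z))
    hp.2.summable

theorem IsProb.tsum_ofReal_sub_softThreshold (hp : IsProb p) (hε : 0 ≤ ε) :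
    ∑' z, ENNReal.ofReal (p z - softThreshold ε (p z)) =
      ENNReal.ofReal (1 - ∑' z, softThreshold ε (p z)) := by
  rw [← ENNReal.ofReal_tsum_of_nonneg (fun z => sub_nonneg.2 (softThreshold_le hε (hp.1 z)))
    (hp.2.summable.sub (hp.summable_softThreshold hε)),
    hp.2.summable.tsum_sub (hp.summable_softThreshold hε), hp.2.tsum_eq]

theorem IsProb.truncation (hp : IsProb p) (hε : 0 ≤ ε)
    (hm : 0 < ∑' z, softThreshold ε (p z)) : IsProb (truncation ε p) := by
  refine ⟨fun z => div_nonneg (softThreshold_nonneg _ _) hm.le, ?_⟩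
  have := (hp.summable_softThreshold hε).hasSum.div_const (∑' z, softThreshold ε (p z))
  rwa [div_self hm.ne'] at this

theorem IsProb.finite_support_truncation (hp : IsProb p) (hε : 0 < ε) :
    (Function.support (_root_.truncation ε p)).Finite := by
  have h : ∀ᶠ z in cofinite, p z < ε ^ 2 :=
    hp.2.summable.tendsto_cofinite_zero.eventually_lt_const (by positivity)
  refine (eventually_cofinite.1 h).subset fun z hz hlt => hz ?_
  simp [_root_.truncation, softThreshold_eq_zero hε.le hlt.le]

theorem dirS_truncation_le (hm : 0 < ∑' z, softThreshold ε (p z)) :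
    dirS (truncation ε p) ≤ ENNReal.ofReal (∑' z, softThreshold ε (p z))⁻¹ * dirS p := by
  unfold dirS
  rw [mul_left_comm, ← ENNReal.tsum_mul_left]
  simp_rw [← ENNReal.tsum_mul_left]
  gcongr with z x
  split_ifs
  · rw [← ENNReal.ofReal_mul (inv_nonneg.2 hm.le)]
    refine ENNReal.ofReal_le_ofReal ?_
    simp only [truncation, Real.sqrt_div (softThreshold_nonneg _ _)]
    rw [← sub_div, div_pow, Real.sq_sqrt hm.le, div_eq_inv_mul]
    refine mul_le_mul_of_nonneg_left ?_ (inv_nonneg.2 hm.le)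
    simp only [softThreshold, Real.sqrt_sq (le_max_right _ _)]
    rw [sq_le_sq]
    simpa using abs_max_sub_max_le_abs (√(p x) - ε) (√(p z) - ε) 0
  · simp

theorem FDE_truncation_le (hp : IsProb p) (hε : 0 ≤ ε) {ρ κ : ℝ} (hρ : 0 ≤ ρ) (hκ : 0 ≤ κ)
    (hm : 0 < ∑' z, softThreshold ε (p z)) {φ : ℝ → ℝ}
    (hφ : ∀ x, 0 ≤ x → x ≤ 1 → -(ρ * (softThreshold ε x * Real.log (softThreshold ε x))) ≤
      φ x + (ρ * (x - softThreshold ε x) + ρ * κ * x)) :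
    FDE ρ (truncation ε p) ≤ ENNReal.ofReal (∑' z, softThreshold ε (p z))⁻¹ *
      (dirS p + ∑' z, ENNReal.ofReal (φ (p z)) +
        ENNReal.ofReal (ρ * (1 - ∑' z, softThreshold ε (p z) + κ))) := by
  have hm1 := hp.tsum_softThreshold_le_one hε
  have hsub := hp.tsum_ofReal_sub_softThreshold hε
  have hdir := dirS_truncation_le hm
  set m := ∑' z, softThreshold ε (p z) with hmdef
  have key : ∑' z, ENNReal.ofReal (-(ρ * (truncation ε p z * Real.log (truncation ε p z)))) ≤
      ENNReal.ofReal m⁻¹ * (∑' z, ENNReal.ofReal (φ (p z)) + ENNReal.ofReal (ρ * (1 - m + κ))) := by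
    calc _ ≤ ∑' z, ENNReal.ofReal m⁻¹ * (ENNReal.ofReal (φ (p z)) +
          (ENNReal.ofReal ρ * ENNReal.ofReal (p z - softThreshold ε (p z)) +
            ENNReal.ofReal (ρ * κ * p z))) := by
          refine ENNReal.tsum_le_tsum fun z => ?_
          have hT := softThreshold_nonneg ε (p z)
          have hlog : -(ρ * (truncation ε p z * Real.log (truncation ε p z))) ≤
              m⁻¹ * -(ρ * (softThreshold ε (p z) * Real.log (softThreshold ε (p z)))) := by
            simp only [truncation, ← hmdef]
            rcases hT.eq_or_lt with h | h
            · simp [← h]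
            rw [Real.log_div h.ne' hm.ne']
            have : 0 ≤ m⁻¹ * (ρ * (softThreshold ε (p z) * -Real.log m)) :=
              mul_nonneg (inv_nonneg.2 hm.le) (mul_nonneg hρ (mul_nonneg hT
                (neg_nonneg.2 (Real.log_nonpos hm.le hm1))))
            rw [div_eq_inv_mul]
            linarith
          rw [← ENNReal.ofReal_mul hρ]
          refine (ENNReal.ofReal_le_ofReal (hlog.trans (mul_le_mul_of_nonneg_left
            (hφ _ (hp.1 z) (hp.le_one z)) (inv_nonneg.2 hm.le)))).trans ?_
          rw [ENNReal.ofReal_mul (inv_nonneg.2 hm.le)]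
          gcongr
          exact ENNReal.ofReal_add_le.trans (by gcongr; exact ENNReal.ofReal_add_le)
      _ = _ := by
          rw [ENNReal.tsum_mul_left, ENNReal.tsum_add, ENNReal.tsum_add, ENNReal.tsum_mul_left,
            hsub, hp.tsum_ofReal_mul (mul_nonneg hρ hκ), ← ENNReal.ofReal_mul hρ,
            ← ENNReal.ofReal_add (mul_nonneg hρ (sub_nonneg.2 hm1)) (mul_nonneg hρ hκ), mul_add ρ]
  unfold FDE
  rw [add_assoc, mul_add]
  exact add_le_add hdir key

theorem IsProb.tendsto_tsum_softThreshold (hp : IsProb p) :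
    Tendsto (fun ε => ∑' z, softThreshold ε (p z)) (𝓝[>] 0) (𝓝 1) := by
  rw [← hp.2.tsum_eq]
  refine tendsto_tsum_of_dominated_convergence hp.2.summable (fun z => ?_) ?_
  · have h : Continuous fun ε => softThreshold ε (p z) := by unfold softThreshold; fun_prop
    have h0 : softThreshold 0 (p z) = p z := by
      simp [softThreshold, Real.sq_sqrt (hp.1 z)]
    simpa only [h0] using (h.tendsto 0).mono_left nhdsWithin_le_nhds
  · filter_upwards [self_mem_nhdsWithin] with ε hε z
    rw [Real.norm_of_nonneg (softThreshold_nonneg _ _)]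
    exact softThreshold_le (le_of_lt hε) (hp.1 z)

/-- Finitely supported measures suffice in the variational problem defining `chiDE`. -/
theorem exists_finite_support_FDE_lt {ρ : ℝ} (hρ : 0 ≤ ρ) {c : ℝ≥0∞} (hc : chiDE d ρ < c) :
    ∃ q : Zd d → ℝ, IsProb q ∧ (Function.support q).Finite ∧ FDE ρ q < c := by
  obtain ⟨⟨p, hp⟩, hpc⟩ := iInf_lt_iff.1 hc
  have hm := hp.tendsto_tsum_softThreshold
  have hlim : Tendsto (fun ε => ENNReal.ofReal (∑' z, softThreshold ε (p z))⁻¹ *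
      (FDE ρ p + ENNReal.ofReal (ρ * (1 - ∑' z, softThreshold ε (p z) + 0)))) (𝓝[>] 0)
      (𝓝 (FDE ρ p)) := by
    have h1 := ENNReal.tendsto_ofReal (hm.inv₀ one_ne_zero)
    have h2 := ENNReal.tendsto_ofReal (((hm.const_sub 1).add_const 0).const_mul ρ)
    have := ENNReal.Tendsto.mul h1 (by simp) (h2.const_add (FDE ρ p)) (by simp)
    simpa using this
  obtain ⟨ε, hε, hεc, hmε⟩ := (eventually_mem_nhdsWithin.and
    ((hlim.eventually_lt_const hpc).and (hm.eventually_const_lt one_pos))).exists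
  have hε : 0 < ε := hε
  refine ⟨truncation ε p, hp.truncation hε.le hmε, hp.finite_support_truncation hε,
    (FDE_truncation_le hp hε.le hρ le_rfl hmε (φ := fun x => -(ρ * (x * Real.log x)))
      fun x hx0 hx1 => ?_).trans_lt hεc⟩
  have := mul_le_mul_of_nonneg_left (neg_mul_log_le_add_sub (softThreshold_nonneg ε x)
    (softThreshold_le hε.le hx0) hx1) hρ
  linarith

end Truncation

theorem mpow_eq_mul_exp {x : ℝ} (hx : 0 < x) (γ : ℝ) :
    mpow x γ = x * Real.exp ((γ - 1) * Real.log x) := by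
  rw [mpow, if_neg hx.ne', Real.rpow_def_of_pos hx]
  conv_rhs => lhs; rw [← Real.exp_log hx]
  rw [← Real.exp_add]
  ring_nf

theorem mul_log_mul_le_mpow_sub {x : ℝ} (hx : 0 ≤ x) (γ : ℝ) :
    (γ - 1) * (x * Real.log x) ≤ mpow x γ - x := by
  rcases hx.eq_or_lt with rfl | hx
  · simp [mpow]
  rw [mpow_eq_mul_exp hx]
  nlinarith [mul_le_mul_of_nonneg_left (Real.add_one_le_exp ((γ - 1) * Real.log x)) hx.le]

theorem chiDE_le_chiDB (d : ℕ) {γ ρ : ℝ} (hρ : 0 ≤ ρ) (hγ : γ < 1) :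
    chiDE d ρ ≤ chiDB d γ ρ := by
  refine iInf_mono fun p => ?_
  unfold FDE FDB
  gcongr with z
  have h := mul_log_mul_le_mpow_sub (p.2.1 z) γ
  have h1 : 0 < 1 - γ := sub_pos.2 hγ
  have := mul_le_mul_of_nonneg_left h (div_nonneg hρ h1.le)
  refine le_trans (le_of_eq ?_) this
  field_simp
  ring

theorem chiDB_le_chiDE (d : ℕ) {γ ρ : ℝ} (hρ : 0 ≤ ρ) (hγ : 1 < γ) :
    chiDB d γ ρ ≤ chiDE d ρ := by
  refine iInf_mono fun p => ?_
  unfold FDE FDB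
  gcongr with z
  have h := mul_log_mul_le_mpow_sub (p.2.1 z) γ
  have h1 : 1 - γ < 0 := sub_neg.2 hγ
  have h2 := h1.ne
  have := mul_le_mul_of_nonpos_left h (div_nonpos_of_nonneg_of_nonpos hρ h1.le)
  refine this.trans (le_of_eq ?_)
  field_simp
  ring

theorem tendsto_mpow_sub_div {x : ℝ} (hx : 0 ≤ x) (ρ : ℝ) :
    Tendsto (fun γ => ρ / (1 - γ) * (mpow x γ - x)) (𝓝[≠] 1) (𝓝 (-(ρ * (x * Real.log x)))) := by
  rcases hx.eq_or_lt with rfl | hx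
  · simp [mpow]
  have h := hasDerivAt_iff_tendsto_slope.1 (Real.hasStrictDerivAt_const_rpow hx 1).hasDerivAt
  simp only [Real.rpow_one] at h
  rw [← neg_mul]
  refine (h.const_mul (-ρ)).congr fun γ => ?_
  rw [slope_def_field, mpow, if_neg hx.ne', Real.rpow_one, ← neg_sub γ 1, div_neg]
  ring

theorem tendsto_FDB_of_finite_support {d : ℕ} {p : Zd d → ℝ} (hp : ∀ z, 0 ≤ p z)
    (hfin : (Function.support p).Finite) (ρ : ℝ) :
    Tendsto (fun γ => FDB γ ρ p) (𝓝[≠] 1) (𝓝 (FDE ρ p)) := by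
  have h0 : ∀ z ∉ hfin.toFinset, p z = 0 := fun z hz => by simpa using hz
  unfold FDB FDE
  rw [tsum_eq_sum (s := hfin.toFinset) fun z hz => by simp [h0 z hz]]
  refine Tendsto.const_add _ ?_
  have h : ∀ γ, ∑' z, ENNReal.ofReal (ρ / (1 - γ) * (mpow (p z) γ - p z)) =
      ∑ z ∈ hfin.toFinset, ENNReal.ofReal (ρ / (1 - γ) * (mpow (p z) γ - p z)) := fun γ =>
    tsum_eq_sum fun z hz => by simp [h0 z hz, mpow]
  simp_rw [h]
  exact tendsto_finsetSum _ fun z _ => ENNReal.tendsto_ofReal (tendsto_mpow_sub_div (hp z) ρ)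

theorem exp_neg_le_quadratic {u : ℝ} (hu : 0 ≤ u) : Real.exp (-u) ≤ 1 - u + u ^ 2 / 2 := by
  have h := Real.quadratic_le_exp_of_nonneg hu
  have h2 : 0 < 1 - u + u ^ 2 / 2 := by nlinarith [sq_nonneg (u - 1)]
  rw [Real.exp_neg, inv_le_iff_one_le_mul₀ (Real.exp_pos u)]
  nlinarith [mul_le_mul_of_nonneg_left h h2.le, sq_nonneg (u ^ 2)]

theorem mpow_penalty_nonneg {x γ ρ : ℝ} (hx0 : 0 ≤ x) (hx1 : x ≤ 1) (hρ : 0 ≤ ρ) (hγ : 1 < γ) :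
    0 ≤ ρ / (1 - γ) * (mpow x γ - x) := by
  refine mul_nonneg_of_nonpos_of_nonpos
    (div_nonpos_of_nonneg_of_nonpos hρ (by linarith)) (sub_nonpos.2 ?_)
  rcases hx0.eq_or_lt with rfl | hx
  · simp [mpow]
  rw [mpow_eq_mul_exp hx]
  exact mul_le_of_le_one_right hx.le (Real.exp_le_one_iff.2
    (mul_nonpos_of_nonneg_of_nonpos (by linarith) (Real.log_nonpos hx0 hx1)))

/-- Second order lower bound for the penalty, with `-ℓ` any upper bound of `log x`. -/
theorem le_mpow_penalty {x γ ρ ℓ : ℝ} (hx : 0 < x) (hρ : 0 ≤ ρ) (hγ : 1 < γ) (hℓ : 0 ≤ ℓ)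
    (hxℓ : Real.log x ≤ -ℓ) :
    ρ * x * (ℓ - (γ - 1) * ℓ ^ 2 / 2) ≤ ρ / (1 - γ) * (mpow x γ - x) := by
  have hδ : 0 < γ - 1 := sub_pos.2 hγ
  have h1 : Real.exp ((γ - 1) * Real.log x) ≤ Real.exp (-((γ - 1) * ℓ)) :=
    Real.exp_le_exp.2 (by nlinarith)
  have h2 := h1.trans (exp_neg_le_quadratic (mul_nonneg hδ.le hℓ))
  rw [mpow_eq_mul_exp hx, ← neg_sub γ 1, div_neg]
  calc ρ * x * (ℓ - (γ - 1) * ℓ ^ 2 / 2)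
      = ρ / (γ - 1) * x * (1 - (1 - (γ - 1) * ℓ + ((γ - 1) * ℓ) ^ 2 / 2)) := by
        field_simp
        ring
    _ ≤ ρ / (γ - 1) * x * (1 - Real.exp ((γ - 1) * Real.log x)) := by gcongr
    _ = _ := by ring

theorem neg_softThreshold_mul_log_le {x γ ρ L : ℝ} (hx0 : 0 ≤ x) (hx1 : x ≤ 1) (hρ : 0 ≤ ρ)
    (hγ : 1 < γ) (hL : 0 ≤ L) :
    -(ρ * (softThreshold (Real.exp (-L)) x * Real.log (softThreshold (Real.exp (-L)) x))) ≤
      ρ / (1 - γ) * (mpow x γ - x) +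
        (ρ * (x - softThreshold (Real.exp (-L)) x) + ρ * (2 * L ^ 2 * (γ - 1)) * x) := by
  have hδ : 0 < γ - 1 := sub_pos.2 hγ
  have hε := (Real.exp_pos (-L)).le
  rcases le_or_gt x (Real.exp (-L) ^ 2) with h | h
  · have := mpow_penalty_nonneg hx0 hx1 hρ hγ
    rw [softThreshold_eq_zero hε h]
    simp only [zero_mul, mul_zero, neg_zero]
    positivity
  have hx : 0 < x := lt_trans (by positivity) h
  have hlog : -(2 * L) ≤ Real.log x := by
    rw [Real.le_log_iff_exp_le hx]
    refine le_trans (le_of_eq ?_) h.le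
    rw [← Real.exp_nat_mul]
    push_cast
    ring_nf
  have hlog0 := Real.log_nonpos hx0 hx1
  have h1 := le_mpow_penalty hx hρ hγ (neg_nonneg.2 hlog0) (neg_neg (Real.log x)).ge
  have h2 := mul_le_mul_of_nonneg_left (neg_mul_log_le_add_sub (softThreshold_nonneg _ x)
    (softThreshold_le hε hx0) hx1) hρ
  have h3 : Real.log x ^ 2 ≤ (2 * L) ^ 2 := sq_le_sq' hlog (by linarith)
  have h4 := mul_le_mul_of_nonneg_left h3 (by positivity : 0 ≤ ρ * x * (γ - 1))
  linarith

theorem sub_softThreshold_le_penalty {x γ ρ L : ℝ} (hx0 : 0 ≤ x) (hx1 : x ≤ 1) (hρ : 0 < ρ)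
    (hγ : 1 < γ) (hL : 0 < L) (hγL : (γ - 1) * L ≤ 1) :
    x - softThreshold (Real.exp (-L)) x ≤
      2 / (ρ * L) * (ρ / (1 - γ) * (mpow x γ - x)) + 2 * √(Real.exp (-L)) * x := by
  have hpen := mpow_penalty_nonneg hx0 hx1 hρ.le hγ
  rcases le_or_gt x (Real.exp (-L)) with h | h
  · have hT := softThreshold_nonneg (Real.exp (-L)) x
    have h0 : 0 ≤ 2 * √(Real.exp (-L)) * x := by positivity
    suffices x ≤ 2 / (ρ * L) * (ρ / (1 - γ) * (mpow x γ - x)) by linarith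
    rcases hx0.eq_or_lt with rfl | hx
    · positivity
    have h1 := le_mpow_penalty hx hρ.le hγ hL.le ((Real.log_le_iff_le_exp hx).2 h)
    calc x = 2 / (ρ * L) * (ρ * x * (L / 2)) := by field_simp
      _ ≤ 2 / (ρ * L) * (ρ * x * (L - (γ - 1) * L ^ 2 / 2)) := by
        gcongr
        nlinarith
      _ ≤ _ := by gcongr
  · have := sub_softThreshold_le (Real.exp_pos (-L)).le h hx1
    have : 0 ≤ 2 / (ρ * L) * (ρ / (1 - γ) * (mpow x γ - x)) := by positivity
    linarith

theorem IsProb.one_sub_tsum_softThreshold_le {d : ℕ} {p : Zd d → ℝ} (hp : IsProb p)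
    {γ ρ L b : ℝ} (hρ : 0 < ρ) (hγ : 1 < γ) (hL : 0 < L) (hγL : (γ - 1) * L ≤ 1) (hb : 0 ≤ b)
    (h : FDB γ ρ p ≤ ENNReal.ofReal b) :
    1 - ∑' z, softThreshold (Real.exp (-L)) (p z) ≤
      2 / (ρ * L) * b + 2 * √(Real.exp (-L)) := by
  have hc : 0 ≤ 2 / (ρ * L) := by positivity
  have hs : 0 ≤ 2 * √(Real.exp (-L)) := by positivity
  rw [← ENNReal.ofReal_le_ofReal_iff (by positivity),
    ← hp.tsum_ofReal_sub_softThreshold (Real.exp_pos _).le]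
  calc _ ≤ ∑' z, (ENNReal.ofReal (2 / (ρ * L)) *
          ENNReal.ofReal (ρ / (1 - γ) * (mpow (p z) γ - p z)) +
          ENNReal.ofReal (2 * √(Real.exp (-L)) * p z)) := by
        refine ENNReal.tsum_le_tsum fun z => ?_
        rw [← ENNReal.ofReal_mul hc]
        exact (ENNReal.ofReal_le_ofReal (sub_softThreshold_le_penalty (hp.1 z) (hp.le_one z)
          hρ hγ hL hγL)).trans ENNReal.ofReal_add_le
    _ ≤ ENNReal.ofReal (2 / (ρ * L)) * ENNReal.ofReal b +
          ENNReal.ofReal (2 * √(Real.exp (-L))) := by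
        rw [ENNReal.tsum_add, ENNReal.tsum_mul_left, hp.tsum_ofReal_mul hs]
        gcongr
        exact le_add_self.trans h
    _ = _ := by
        rw [← ENNReal.ofReal_mul hc, ← ENNReal.ofReal_add (by positivity) hs]

theorem chiDE_le_of_FDB_le {d : ℕ} {p : Zd d → ℝ} (hp : IsProb p) {γ ρ L b η : ℝ} (hρ : 0 < ρ)
    (hγ : 1 < γ) (hL : 0 < L) (hγL : (γ - 1) * L ≤ 1) (hb : 0 ≤ b)
    (h : FDB γ ρ p ≤ ENNReal.ofReal b) (hη : η < 1)
    (hmass : 2 / (ρ * L) * b + 2 * √(Real.exp (-L)) ≤ η) (hent : 2 * L ^ 2 * (γ - 1) ≤ η) :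
    chiDE d ρ ≤ ENNReal.ofReal ((1 - η)⁻¹ * (b + ρ * (η + η))) := by
  have hm := (hp.one_sub_tsum_softThreshold_le hρ hγ hL hγL hb h).trans hmass
  have hε := (Real.exp_pos (-L)).le
  have hm0 : 0 < ∑' z, softThreshold (Real.exp (-L)) (p z) := by linarith
  have hη0 : 0 ≤ η := le_trans (by positivity) hmass
  have hκ : 0 ≤ 2 * L ^ 2 * (γ - 1) := mul_nonneg (by positivity) (by linarith)
  calc chiDE d ρ ≤ FDE ρ (truncation (Real.exp (-L)) p) :=
        iInf_le (fun q : {q : Zd d → ℝ // IsProb q} => FDE ρ q.1) ⟨_, hp.truncation hε hm0⟩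
    _ ≤ ENNReal.ofReal (∑' z, softThreshold (Real.exp (-L)) (p z))⁻¹ *
          (FDB γ ρ p + ENNReal.ofReal (ρ * (1 - ∑' z, softThreshold (Real.exp (-L)) (p z) +
            2 * L ^ 2 * (γ - 1)))) :=
        FDE_truncation_le hp hε hρ.le hκ hm0
          (φ := fun x => ρ / (1 - γ) * (mpow x γ - x))
          fun x hx0 hx1 => neg_softThreshold_mul_log_le hx0 hx1 hρ.le hγ hL.le
    _ ≤ ENNReal.ofReal (1 - η)⁻¹ * (ENNReal.ofReal b + ENNReal.ofReal (ρ * (η + η))) := by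
        gcongr
        linarith
    _ = _ := by
        rw [← ENNReal.ofReal_add hb (by positivity), ← ENNReal.ofReal_mul
          (inv_nonneg.2 (by linarith))]

theorem tendsto_chiDB_left (d : ℕ) {ρ : ℝ} (hρ : 0 ≤ ρ) :
    Tendsto (fun γ => chiDB d γ ρ) (𝓝[<] 1) (𝓝 (chiDE d ρ)) := by
  refine tendsto_order.2 ⟨fun c hc => ?_, fun c hc => ?_⟩
  · filter_upwards [self_mem_nhdsWithin] with γ hγ
    exact hc.trans_le (chiDE_le_chiDB d hρ hγ)
  · obtain ⟨q, hq, hfin, hqc⟩ := exists_finite_support_FDE_lt hρ hc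
    have hlim := (tendsto_FDB_of_finite_support hq.1 hfin ρ).mono_left
      (nhdsWithin_mono 1 fun γ (hγ : γ < 1) => hγ.ne)
    filter_upwards [hlim.eventually_lt_const hqc] with γ hγ
    exact (iInf_le (fun q : {q : Zd d → ℝ // IsProb q} => FDB γ ρ q.1) ⟨q, hq⟩).trans_lt hγ

theorem tendsto_chiDB_right (d : ℕ) {ρ : ℝ} (hρ : 0 < ρ) :
    Tendsto (fun γ => chiDB d γ ρ) (𝓝[>] 1) (𝓝 (chiDE d ρ)) := by
  refine tendsto_order.2 ⟨fun c hc => ?_, fun c hc => ?_⟩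
  · obtain ⟨b, hcb, hb⟩ := ENNReal.lt_iff_exists_nnreal_btwn.1 hc
    obtain ⟨b', hbb', hb'⟩ := ENNReal.lt_iff_exists_nnreal_btwn.1 hb
    have hbb' : (b : ℝ) < b' := by exact_mod_cast hbb'
    have hη : ∀ᶠ η in 𝓝[>] (0 : ℝ), (1 - η)⁻¹ * (b + ρ * (η + η)) < b' := by
      have : Tendsto (fun η : ℝ => (1 - η)⁻¹ * (b + ρ * (η + η))) (𝓝 0)
          (𝓝 ((1 - 0)⁻¹ * (b + ρ * (0 + 0)))) := by
        refine ContinuousAt.mul (ContinuousAt.inv₀ (by fun_prop) (by simp)) (by fun_prop)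
      exact nhdsWithin_le_nhds (this.eventually_lt_const (by simpa using hbb'))
    obtain ⟨η, hηb, hη1, hη0⟩ := (hη.and (((eventually_lt_nhds one_pos).filter_mono
      nhdsWithin_le_nhds).and self_mem_nhdsWithin)).exists
    have hη0 : 0 < η := hη0
    have hL : Tendsto (fun L : ℝ => 2 / (ρ * L) * b + 2 * √(Real.exp (-L))) atTop (𝓝 0) := by
      have h1 : Tendsto (fun L : ℝ => 2 / (ρ * L)) atTop (𝓝 0) :=
        tendsto_const_nhds.div_atTop (tendsto_id.const_mul_atTop hρ)
      have h2 := (Real.continuous_sqrt.tendsto 0).comp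
        (Real.tendsto_exp_neg_atTop_nhds_zero)
      simpa using (h1.mul_const (b : ℝ)).add (h2.const_mul 2)
    obtain ⟨L, hLη, hL0⟩ := ((hL.eventually_lt_const hη0).and (eventually_gt_atTop 0)).exists
    have hγ1 : ∀ᶠ γ in 𝓝[>] (1 : ℝ), (γ - 1) * L < 1 :=
      nhdsWithin_le_nhds ((show Continuous fun γ : ℝ => (γ - 1) * L by fun_prop).tendsto 1
        |>.eventually_lt_const (by simp))
    have hγ2 : ∀ᶠ γ in 𝓝[>] (1 : ℝ), 2 * L ^ 2 * (γ - 1) < η :=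
      nhdsWithin_le_nhds ((show Continuous fun γ : ℝ => 2 * L ^ 2 * (γ - 1) by fun_prop).tendsto 1
        |>.eventually_lt_const (by simpa using hη0))
    filter_upwards [hγ1, hγ2, self_mem_nhdsWithin] with γ hγ1 hγ2 hγ
    refine hcb.trans_le (le_iInf fun p => le_of_not_ge fun hp => hb'.not_ge ?_)
    rw [← ENNReal.ofReal_coe_nnreal] at hp
    refine (chiDE_le_of_FDB_le p.2 hρ hγ hL0 hγ1.le b.2 hp hη1 hLη.le hγ2.le).trans ?_
    rw [← ENNReal.ofReal_coe_nnreal]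
    exact ENNReal.ofReal_le_ofReal hηb.le
  · filter_upwards [self_mem_nhdsWithin] with γ hγ
    exact (chiDB_le_chiDE d hρ.le hγ).trans_lt hc

/-- `χ^{DB}_γ(ρ) → χ^{DE}(ρ)` as `γ → 1` through `[0, 1+2/d) \ {1}`. -/
theorem stmt5 (d : ℕ) (hd : 1 ≤ d) (ρ : ℝ) (hρ : 0 < ρ) :
    Tendsto (fun γ => chiDB d γ ρ)
      (𝓝[Set.Ico 0 (1 + 2 / d) \ {1}] 1) (𝓝 (chiDE d ρ)) := by
  have h := (tendsto_chiDB_left d hρ.le).sup (tendsto_chiDB_right d hρ)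
  rw [← nhdsWithin_union, Set.Iio_union_Ioi] at h
  exact h.mono_left (nhdsWithin_mono 1 fun γ hγ => hγ.2)
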